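/- For every integer d ≥ 2, the language NPal#_d = {w₁ # w₂ # ⋯ # w_d # v₁ # v₂ # ⋯ # v_d : wᵢ, vᵢ ∈ {0,1}* and vᵢ ≠ wᵢ^R for all i ∈ [d]} over the alphabet {0,1,#}, where wᵢ^R denotes the reverse of wᵢ, belongs to DCFL(d) but does not belong to DCFL(d−1). -/

import Mathlib

/-!
Formalization of one-way deterministic pushdown automata (1dpda) following
Yamakami, "Intersection and Union Hierarchies of Deterministic Context-Free
Languages and Pumping Lemmas".
-/

namespace DCFLFormal

/-- Tape symbols: the left endmarker ¢, the right endmarker $, and input symbols. -/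
inductive TSym (α : Type) : Type
  | lend : TSym α
  | rend : TSym α
  | ch : α → TSym α

/-- A one-way deterministic pushdown automaton (1dpda).  `δ q (some t) a` is the
transition reading the tape symbol `t` with top stack symbol `a`; `δ q none a`
is the ε-transition.  The value `some (p, w)` means: change state to `p` and
replace the topmost stack symbol by the string `w`. -/
structure DPDA (Q α Γ : Type) where
  δ : Q → Option (TSym α) → Γ → Option (Q × List Γ)
  q0 : Q
  Z0 : Γ
  Acc : Set Q
  Rej : Set Q

/-- A configuration: current state, remaining (unread) tape, and stack content
(topmost symbol first, the bottom marker last). -/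
structure Cfg (Q α Γ : Type) where
  st : Q
  inp : List (TSym α)
  stk : List Γ

namespace DPDA

variable {Q α Γ : Type}

/-- Halting (accepting or rejecting) states. -/
def IsHalting (M : DPDA Q α Γ) (q : Q) : Prop := q ∈ M.Acc ∨ q ∈ M.Rej

/-- One step of the machine: an ε-move if one is defined, otherwise read the
next tape symbol; the head moves right exactly when a tape symbol is read. -/
def step (M : DPDA Q α Γ) (c : Cfg Q α Γ) : Option (Cfg Q α Γ) :=
  match c.stk with
  | [] => none
  | a :: s =>
    match M.δ c.st none a with
    | some (p, w) => some ⟨p, c.inp, w ++ s⟩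
    | none =>
      match c.inp with
      | [] => none
      | t :: rest =>
        match M.δ c.st (some t) a with
        | some (p, w) => some ⟨p, rest, w ++ s⟩
        | none => none

/-- Iterated steps. -/
def stepN (M : DPDA Q α Γ) : ℕ → Cfg Q α Γ → Option (Cfg Q α Γ)
  | 0, c => some c
  | n + 1, c => (M.step c).bind (M.stepN n)

/-- The tape holding ¢ x $. -/
def tape (x : List α) : List (TSym α) :=
  TSym.lend :: x.map TSym.ch ++ [TSym.rend]

/-- The initial configuration on input `x`. -/
def init (M : DPDA Q α Γ) (x : List α) : Cfg Q α Γ := ⟨M.q0, tape x, [M.Z0]⟩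

/-- `M` accepts `x`: the computation reaches an accepting state. -/
def Accepts (M : DPDA Q α Γ) (x : List α) : Prop :=
  ∃ n c, M.stepN n (M.init x) = some c ∧ c.st ∈ M.Acc

/-- `M` rejects `x`: the computation reaches a rejecting state. -/
def Rejects (M : DPDA Q α Γ) (x : List α) : Prop :=
  ∃ n c, M.stepN n (M.init x) = some c ∧ c.st ∈ M.Rej

/-- `M` halts (in an accepting or rejecting state) on every input. -/
def HaltsOnAll (M : DPDA Q α Γ) : Prop :=
  ∀ x : List α, ∃ n c, M.stepN n (M.init x) = some c ∧ M.IsHalting c.st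

/-- The language recognized by `M`. -/
def lang (M : DPDA Q α Γ) : Set (List α) := {x | M.Accepts x}

/-- Well-formedness of a 1dpda: accepting and rejecting states are disjoint,
halting states have no outgoing transitions, for every non-halting state,
stack symbol and (non-empty) tape symbol exactly one of the symbol- and the
ε-transition is defined, and the bottom marker Z₀ is never removed. -/
def Valid (M : DPDA Q α Γ) : Prop :=
  (∀ q, q ∈ M.Acc → q ∉ M.Rej) ∧
  (∀ q, M.IsHalting q → ∀ σ a, M.δ q σ a = none) ∧
  (∀ q, ¬ M.IsHalting q → ∀ σ a, ((M.δ q (some σ) a).isSome ↔ M.δ q none a = none)) ∧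
  (∀ q σ p w, M.δ q σ M.Z0 = some (p, w) → w ≠ [])

end DPDA

/-- A language is deterministic context-free if it is recognized by some 1dpda
(with finitely many states and stack symbols) that halts on all inputs. -/
def IsDCFL {α : Type} (L : Set (List α)) : Prop :=
  ∃ (Q Γ : Type) (_ : Fintype Q) (_ : Fintype Γ) (M : DPDA Q α Γ),
    M.Valid ∧ M.HaltsOnAll ∧ L = M.lang

/-- `DCFL(d)`: intersections of `d` dcf languages. -/
def DCFLInter {α : Type} (d : ℕ) (L : Set (List α)) : Prop :=
  ∃ f : Fin d → Set (List α), (∀ i, IsDCFL (f i)) ∧ L = ⋂ i, f i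

/-- `DCFL[d]`: unions of `d` dcf languages. -/
def DCFLUnion {α : Type} (d : ℕ) (L : Set (List α)) : Prop :=
  ∃ f : Fin d → Set (List α), (∀ i, IsDCFL (f i)) ∧ L = ⋃ i, f i

/-- `rep x i` is the string `x` repeated `i` times. -/
def rep {α : Type} (x : List α) (i : ℕ) : List α := (List.replicate i x).flatten

/-- `(x, y)` is an iterative pair of the string `u ++ x ++ v ++ y ++ z` for `L`. -/
def IterPair {α : Type} (L : Set (List α)) (u x v y z : List α) : Prop :=
  1 ≤ (x ++ y).length ∧ ∀ i : ℕ, u ++ rep x i ++ v ++ rep y i ++ z ∈ L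

/-- A nondegenerate iterative pair: either `{u xⁱ v yʲ z ∈ L : j ≥ 0}` is finite
for each `i`, or `{u xⁱ v yʲ z ∈ L : i ≥ 0}` is finite for each `j`. -/
def NonDegIterPair {α : Type} (L : Set (List α)) (u x v y z : List α) : Prop :=
  IterPair L u x v y z ∧
  ((∀ i : ℕ, {s | s ∈ L ∧ ∃ j : ℕ, s = u ++ rep x i ++ v ++ rep y j ++ z}.Finite) ∨
   (∀ j : ℕ, {s | s ∈ L ∧ ∃ i : ℕ, s = u ++ rep x i ++ v ++ rep y j ++ z}.Finite))


/-- The language `NPal#_d = {w₁#⋯#w_d#v₁#⋯#v_d : wᵢ, vᵢ ∈ {0,1}*, vᵢ ≠ wᵢ^R}`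
over the alphabet `Option Bool` (where `some b` is a bit and `none` is `#`). -/
def NPalSharp (d : ℕ) : Set (List (Option Bool)) :=
  {s | ∃ w v : Fin d → List Bool, (∀ i, v i ≠ (w i).reverse) ∧
    s = (List.ofFn fun i => (w i).map some ++ [(none : Option Bool)]).flatten ++
        (List.intersperse [(none : Option Bool)]
          (List.ofFn fun i => (v i).map (some : Bool → Option Bool))).flatten}

namespace DPDA

section Runs

variable {Q α Γ : Type} (M : DPDA Q α Γ)

/-- `c'` is reached from `c` by finitely many steps. -/
def Reaches : Cfg Q α Γ → Cfg Q α Γ → Prop :=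
  Relation.ReflTransGen fun c c' => M.step c = some c'

theorem reaches_iff_stepN {c c' : Cfg Q α Γ} :
    M.Reaches c c' ↔ ∃ n, M.stepN n c = some c' := by
  constructor
  · intro h
    induction h using Relation.ReflTransGen.head_induction_on with
    | refl => exact ⟨0, rfl⟩
    | head h _ ih =>
      obtain ⟨n, hn⟩ := ih
      exact ⟨n + 1, by simp [stepN, h, hn]⟩
  · rintro ⟨n, hn⟩
    induction n generalizing c with
    | zero =>
      obtain rfl : c = c' := by simpa [stepN] using hn
      exact .refl
    | succ n ih =>
      obtain ⟨d, hd, hn⟩ := Option.bind_eq_some_iff.mp hn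
      exact .head hd (ih hn)

theorem step_eq_some_iff {q : Q} {y : List (TSym α)} {s : List Γ} {c : Cfg Q α Γ} :
    M.step ⟨q, y, s⟩ = some c ↔ ∃ a s' p w, s = a :: s' ∧
      ((M.δ q none a = some (p, w) ∧ c = ⟨p, y, w ++ s'⟩) ∨
        (M.δ q none a = none ∧ ∃ t r, y = t :: r ∧ M.δ q (some t) a = some (p, w) ∧
          c = ⟨p, r, w ++ s'⟩)) := by
  rcases s with _ | ⟨a, s⟩
  · simp [step]
  rcases h : M.δ q none a with _ | ⟨p, w⟩
  · rcases y with _ | ⟨t, r⟩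
    · simp [step, h]
    · rcases h' : M.δ q (some t) a with _ | ⟨p, w⟩
      · simp [step, h, h']
      · simp [step, h, h', eq_comm]
  · simp [step, h, eq_comm]

variable {M}

theorem Reaches.total {c d e : Cfg Q α Γ} (hd : M.Reaches c d) (he : M.Reaches c e) :
    M.Reaches d e ∨ M.Reaches e d :=
  Relation.ReflTransGen.total_of_right_unique
    (fun _ _ _ h h' => Option.some_injective _ (h.symm.trans h')) hd he

theorem Reaches.eq_of_step_eq_none {c d : Cfg Q α Γ} (h : M.Reaches c d)
    (hc : M.step c = none) : d = c := by
  rcases Relation.ReflTransGen.cases_head h with h | ⟨e, he, -⟩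
  · exact h.symm
  · simp [hc] at he

theorem Reaches.of_step_eq_none {c d e : Cfg Q α Γ} (hd : M.Reaches c d) (he : M.Reaches c e)
    (h : M.step e = none) : M.Reaches d e := by
  rcases hd.total he with h' | h'
  · exact h'
  · rw [h'.eq_of_step_eq_none h]
    exact .refl

theorem step_nil_stk (q : Q) (y : List (TSym α)) : M.step ⟨q, y, []⟩ = none := rfl

theorem Valid.step_eq_none (hM : M.Valid) {c : Cfg Q α Γ} (hc : M.IsHalting c.st) :
    M.step c = none := by
  obtain ⟨q, y, s⟩ := c
  rw [Option.eq_none_iff_forall_ne_some]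
  intro c' h
  obtain ⟨a, s', p, w, -, ⟨h, -⟩ | ⟨-, t, r, -, h, -⟩⟩ := M.step_eq_some_iff.mp h <;>
    simp [hM.2.1 q hc] at h

theorem Reaches.append_inp {c d : Cfg Q α Γ} (h : M.Reaches c d) (z : List (TSym α)) :
    M.Reaches ⟨c.st, c.inp ++ z, c.stk⟩ ⟨d.st, d.inp ++ z, d.stk⟩ := by
  induction h with
  | refl => exact .refl
  | tail _ h ih =>
    refine ih.tail ?_
    obtain ⟨a, s', p, w, hs, ⟨hδ, rfl⟩ | ⟨h', t, r, hy, hδ, rfl⟩⟩ := M.step_eq_some_iff.mp h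
    · exact M.step_eq_some_iff.mpr ⟨a, s', p, w, hs, .inl ⟨hδ, rfl⟩⟩
    · exact M.step_eq_some_iff.mpr
        ⟨a, s', p, w, hs, .inr ⟨h', t, r ++ z, by simp [hy], hδ, rfl⟩⟩

theorem step_append_stk {c d : Cfg Q α Γ} (h : M.step c = some d) (r : List Γ) :
    M.step ⟨c.st, c.inp, c.stk ++ r⟩ = some ⟨d.st, d.inp, d.stk ++ r⟩ := by
  obtain ⟨a, s', p, w, hs, ⟨hδ, rfl⟩ | ⟨h', t, r', hy, hδ, rfl⟩⟩ := M.step_eq_some_iff.mp h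
  · exact M.step_eq_some_iff.mpr ⟨a, s' ++ r, p, w, by simp [hs], .inl ⟨hδ, by simp⟩⟩
  · exact M.step_eq_some_iff.mpr
      ⟨a, s' ++ r, p, w, by simp [hs], .inr ⟨h', t, r', hy, hδ, by simp⟩⟩

theorem Reaches.append_stk {c d : Cfg Q α Γ} (h : M.Reaches c d) (r : List Γ) :
    M.Reaches ⟨c.st, c.inp, c.stk ++ r⟩ ⟨d.st, d.inp, d.stk ++ r⟩ := by
  induction h with
  | refl => exact .refl
  | tail _ h ih => exact ih.tail (step_append_stk h r)

theorem Reaches.inp_suffix {c d : Cfg Q α Γ} (h : M.Reaches c d) : d.inp <:+ c.inp := by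
  induction h with
  | refl => exact List.suffix_rfl
  | tail _ h ih =>
    obtain ⟨a, s', p, w, hs, ⟨hδ, rfl⟩ | ⟨h', t, r', hy, hδ, rfl⟩⟩ := M.step_eq_some_iff.mp h
    · exact ih
    · exact (hy ▸ List.suffix_cons t r').trans ih

/-- Unread input does not influence a run. -/
theorem Reaches.of_append_inp {q : Q} {y z : List (TSym α)} {s : List Γ} {c : Cfg Q α Γ}
    (h : M.Reaches ⟨q, y ++ z, s⟩ c) {y' : List (TSym α)} (hc : c.inp = y' ++ z) :
    M.Reaches ⟨q, y, s⟩ ⟨c.st, y', c.stk⟩ := by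
  induction h generalizing y' with
  | refl =>
    obtain rfl : y = y' := List.append_cancel_right hc
    exact .refl
  | @tail d e hd h ih =>
    obtain ⟨a, s', p, w, hs, ⟨hδ, rfl⟩ | ⟨h', t, r, hy, hδ, rfl⟩⟩ := M.step_eq_some_iff.mp h
    · exact (ih hc).tail (M.step_eq_some_iff.mpr ⟨a, s', p, w, hs, .inl ⟨hδ, rfl⟩⟩)
    · refine (ih (y' := t :: y') (by simp [hy, ← hc])).tail
        (M.step_eq_some_iff.mpr ⟨a, s', p, w, hs, .inr ⟨h', t, y', rfl, hδ, rfl⟩⟩)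

theorem Reaches.split_inp {q : Q} {y z : List (TSym α)} {s : List Γ} {c : Cfg Q α Γ}
    (h : M.Reaches ⟨q, y ++ z, s⟩ c) :
    (∃ y', c.inp = y' ++ z ∧ M.Reaches ⟨q, y, s⟩ ⟨c.st, y', c.stk⟩) ∨
      ∃ q' s', M.Reaches ⟨q, y, s⟩ ⟨q', [], s'⟩ ∧ M.Reaches ⟨q', z, s'⟩ c := by
  induction h with
  | refl => exact .inl ⟨y, rfl, .refl⟩
  | @tail d e hd h ih =>
    rcases ih with ⟨y', hy', hr⟩ | ⟨q', s', hr, hr'⟩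
    · rcases y' with _ | ⟨t, y'⟩
      · refine .inr ⟨_, _, hr, .single ?_⟩
        rw [← h]
        simp only [List.nil_append] at hy'
        rw [← hy']
      · left
        obtain ⟨y'', hy''⟩ : ∃ y'', e.inp = y'' ++ z := by
          obtain ⟨a, s', p, w, hs, ⟨hδ, rfl⟩ | ⟨h', t', r, hy, hδ, rfl⟩⟩ := M.step_eq_some_iff.mp h
          · exact ⟨_, hy'⟩
          · rw [hy', List.cons_append, List.cons.injEq] at hy
            exact ⟨y', hy.2.symm⟩
        exact ⟨y'', hy'', Reaches.of_append_inp (hd.tail h) hy''⟩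
    · exact .inr ⟨q', s', hr, hr'.tail h⟩

theorem Reaches.split_stk {q : Q} {y : List (TSym α)} {u s : List Γ} {c : Cfg Q α Γ}
    (h : M.Reaches ⟨q, y, u ++ s⟩ c) :
    (∃ u', c.stk = u' ++ s ∧ M.Reaches ⟨q, y, u⟩ ⟨c.st, c.inp, u'⟩) ∨
      ∃ p y', M.Reaches ⟨q, y, u⟩ ⟨p, y', []⟩ ∧ M.Reaches ⟨p, y', s⟩ c := by
  induction h with
  | refl => exact .inl ⟨u, rfl, .refl⟩
  | @tail d e hd h ih =>
    rcases ih with ⟨u', hu', hr⟩ | ⟨p, y', hr, hr'⟩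
    · rcases u' with _ | ⟨a, u'⟩
      · refine .inr ⟨_, _, hr, .single ?_⟩
        rw [← h]
        simp only [List.nil_append] at hu'
        rw [← hu']
      · left
        obtain ⟨a', s', p, w, hs, ⟨hδ, rfl⟩ | ⟨h', t', r, hy, hδ, rfl⟩⟩ := M.step_eq_some_iff.mp h
        · rw [hu', List.cons_append, List.cons.injEq] at hs
          obtain ⟨rfl, rfl⟩ := hs
          exact ⟨w ++ u', by simp,
            hr.tail (M.step_eq_some_iff.mpr ⟨a, u', p, w, rfl, .inl ⟨hδ, rfl⟩⟩)⟩
        · rw [hu', List.cons_append, List.cons.injEq] at hs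
          obtain ⟨rfl, rfl⟩ := hs
          exact ⟨w ++ u', by simp, hr.tail
            (M.step_eq_some_iff.mpr ⟨a, u', p, w, rfl, .inr ⟨h', t', r, hy, hδ, rfl⟩⟩)⟩
    · exact .inr ⟨p, y', hr, hr'.tail h⟩

/-- A run ending with a nonempty stack passes through a last configuration of minimal stack
height, after which the stack below the top symbol stays untouched. -/
theorem Reaches.exists_min_stk {q : Q} {y : List (TSym α)} {s : List Γ} {c : Cfg Q α Γ}
    (h : M.Reaches ⟨q, y, s⟩ c) (hc : c.stk ≠ []) :
    ∃ p y' a B U, B <:+ s ∧ U ≠ [] ∧ c.stk = U ++ B ∧ M.Reaches ⟨q, y, s⟩ ⟨p, y', a :: B⟩ ∧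
      M.Reaches ⟨p, y', [a]⟩ ⟨c.st, c.inp, U⟩ := by
  induction h with
  | refl =>
    obtain ⟨a, B, hs⟩ := List.exists_cons_of_ne_nil hc
    obtain rfl : s = a :: B := hs
    exact ⟨q, y, a, B, [a], List.suffix_cons a B, by simp, rfl, .refl, .refl⟩
  | @tail d e hd h ih =>
    have hd' : d.stk ≠ [] := by
      intro h0
      obtain ⟨q', y', s'⟩ := d
      obtain rfl : s' = [] := h0
      simp [step_nil_stk] at h
    obtain ⟨p, y', a, B, U, hB, hU, hds, hr, hr'⟩ := ih hd'
    obtain ⟨b, U, rfl⟩ := List.exists_cons_of_ne_nil hU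
    obtain ⟨U', heU, hstep⟩ : ∃ U', e.stk = U' ++ B ∧
        M.step ⟨d.st, d.inp, b :: U⟩ = some ⟨e.st, e.inp, U'⟩ := by
      obtain ⟨a', s', p, w, hs, ⟨hδ, rfl⟩ | ⟨h', t', r, hy, hδ, rfl⟩⟩ := M.step_eq_some_iff.mp h
      · rw [hds, List.cons_append, List.cons.injEq] at hs
        obtain ⟨rfl, rfl⟩ := hs
        exact ⟨w ++ U, by simp, M.step_eq_some_iff.mpr ⟨b, U, p, w, rfl, .inl ⟨hδ, rfl⟩⟩⟩
      · rw [hds, List.cons_append, List.cons.injEq] at hs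
        obtain ⟨rfl, rfl⟩ := hs
        exact ⟨w ++ U, by simp,
          M.step_eq_some_iff.mpr ⟨b, U, p, w, rfl, .inr ⟨h', t', r, hy, hδ, rfl⟩⟩⟩
    rcases U' with _ | ⟨b', U'⟩
    · obtain ⟨a', B', hB'⟩ := List.exists_cons_of_ne_nil hc
      obtain rfl : B = a' :: B' := by simpa [heU] using hB'
      refine ⟨e.st, e.inp, a', B', [a'], (List.suffix_cons a' B').trans hB, by simp, hB', ?_, .refl⟩
      rw [← hB']
      exact hd.tail h
    · exact ⟨p, y', a, B, b' :: U', hB, by simp, heU, hr, hr'.tail hstep⟩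

/-- If a rejecting run does not reject while reading `C`, then either all information on `C`
beyond a bounded amount has been popped within `D`, or the symbols below the lowest level
reached within `C` are not used before the end of `D`. -/
theorem reject_dichotomy {q : Q} {S : List Γ} {C D E : List (TSym α)} {c : Cfg Q α Γ}
    (h : M.Reaches ⟨q, C ++ (D ++ E), S⟩ c) (hM : M.Valid) (hc : c.st ∈ M.Rej)
    (hC : ∀ c' : Cfg Q α Γ, M.Reaches ⟨q, C, S⟩ c' → c'.st ∉ M.Rej) :
    (∃ p D' B, D' <:+ D ∧ B <:+ S ∧ M.Reaches ⟨q, C ++ D, S⟩ ⟨p, D', B⟩) ∨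
    ∃ p C' a B, C' <:+ C ∧ M.Reaches ⟨q, C, S⟩ ⟨p, C', a :: B⟩ ∧
      ((∃ c', M.Reaches ⟨p, C' ++ (D ++ E), [a]⟩ c' ∧ c'.st ∈ M.Rej) ∨
        ∃ p' E', E' <:+ E ∧ M.Reaches ⟨p, C' ++ (D ++ E), [a]⟩ ⟨p', E', []⟩ ∧
          ∃ c', M.Reaches ⟨p', E', B⟩ c' ∧ c'.st ∈ M.Rej) := by
  have hcs := hM.step_eq_none (.inr hc)
  rcases h.split_inp with ⟨y', -, hr⟩ | ⟨q₂, S₂, hr, hr₂⟩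
  · exact absurd hc (hC ⟨c.st, y', c.stk⟩ hr)
  have hS₂ : S₂ ≠ [] := by
    rintro rfl
    have := hr₂.eq_of_step_eq_none (step_nil_stk _ _)
    subst this
    exact hC _ hr hc
  obtain ⟨p, C', a, B, U, hB, hU, hS, hrp, hra⟩ := hr.exists_min_stk hS₂
  have hra' := hra.append_inp (D ++ E)
  have hrp' := hrp.append_inp (D ++ E)
  simp only [List.nil_append] at hra'
  have hpc := hrp'.of_step_eq_none h hcs
  rcases Reaches.split_stk (u := [a]) hpc with ⟨u', -, hu'⟩ | ⟨p', Y, hpop, hY⟩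
  · exact .inr ⟨p, C', a, B, hrp.inp_suffix, hrp, .inl ⟨_, hu', hc⟩⟩
  · have hsuf : Y <:+ D ++ E := (hra'.of_step_eq_none hpop (step_nil_stk _ _)).inp_suffix
    rcases le_total Y.length E.length with hlen | hlen
    · exact .inr ⟨p, C', a, B, hrp.inp_suffix, hrp, .inr ⟨p', Y,
        List.suffix_of_suffix_length_le hsuf (List.suffix_append D E) hlen, hpop, c, hY, hc⟩⟩
    · obtain ⟨D', rfl⟩ := List.suffix_of_suffix_length_le (List.suffix_append D E) hsuf hlen
      obtain ⟨T, hT⟩ := hsuf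
      refine .inl ⟨p', D', B, ⟨T, ?_⟩, hB, ?_⟩
      · rw [← List.append_assoc] at hT
        exact List.append_cancel_right hT
      · have h1 : M.Reaches ⟨q, (C ++ D) ++ E, S⟩ ⟨p', D' ++ E, B⟩ := by
          rw [List.append_assoc]
          exact hrp'.trans (hpop.append_stk B)
        exact h1.of_append_inp rfl

end Runs

end DPDA
namespace DPDA

section Height

variable {Q α Γ : Type} {M : DPDA Q α Γ}

theorem HaltsOnAll.exists_halting (hM : M.HaltsOnAll) (x : List α) :
    ∃ c, M.Reaches (M.init x) c ∧ M.IsHalting c.st := by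
  obtain ⟨n, c, hn, hc⟩ := hM x
  exact ⟨c, M.reaches_iff_stepN.mpr ⟨n, hn⟩, hc⟩

theorem Reaches.exists_stk_bound {c h : Cfg Q α Γ} (hr : M.Reaches c h) (hh : M.step h = none) :
    ∃ H, ∀ d, M.Reaches c d → d.stk.length ≤ H := by
  induction hr using Relation.ReflTransGen.head_induction_on with
  | refl => exact ⟨h.stk.length, fun d hd => (hd.eq_of_step_eq_none hh) ▸ le_rfl⟩
  | @head c e hce _ ih =>
    obtain ⟨H, hH⟩ := ih
    refine ⟨max c.stk.length H, fun d hd => ?_⟩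
    rcases Relation.ReflTransGen.cases_head hd with rfl | ⟨e', he', hd'⟩
    · exact le_max_left _ _
    · obtain rfl : e = e' := Option.some_injective _ (hce.symm.trans he')
      exact (hH d hd').trans (le_max_right _ _)

/-- A run that consumes an input symbol contains a first step doing so. -/
theorem Reaches.eq_or_first_read {q : Q} {t : TSym α} {r : List (TSym α)} {s : List Γ}
    {c : Cfg Q α Γ} (h : M.Reaches ⟨q, t :: r, s⟩ c) :
    c.inp = t :: r ∨ ∃ d e, M.Reaches ⟨q, t :: r, s⟩ d ∧ d.inp = t :: r ∧ M.step d = some e ∧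
      e.inp = r ∧ M.Reaches e c := by
  induction h with
  | refl => exact .inl rfl
  | @tail d e hd h ih =>
    rcases ih with ih | ⟨d', e', h1, h2, h3, h4, h5⟩
    · obtain ⟨a, s', p, w, hs, ⟨hδ, rfl⟩ | ⟨h', t', r', hy, hδ, rfl⟩⟩ := M.step_eq_some_iff.mp h
      · exact .inl ih
      · refine .inr ⟨d, _, hd, ih, h, ?_, .refl⟩
        rw [ih, List.cons.injEq] at hy
        exact hy.2.symm
    · exact .inr ⟨d', e', h1, h2, h3, h4, h5.tail h⟩

theorem exists_push_bound [Finite Q] [Finite α] [Finite Γ] (M : DPDA Q α Γ) :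
    ∃ m, ∀ c d, M.step c = some d → d.stk.length ≤ c.stk.length + m := by
  have : Finite (TSym α) := by
    refine Finite.of_surjective (fun o : Option (Option α) => match o with
      | none => TSym.lend
      | some none => TSym.rend
      | some (some a) => TSym.ch a) ?_
    rintro (_ | _ | a)
    exacts [⟨none, rfl⟩, ⟨some none, rfl⟩, ⟨some (some a), rfl⟩]
  obtain ⟨m, hm⟩ := (Set.finite_range fun k : Q × Option (TSym α) × Γ =>
    ((M.δ k.1 k.2.1 k.2.2).map fun r => r.2.length).getD 0).bddAbove
  have key : ∀ q σ a p w, M.δ q σ a = some (p, w) → w.length ≤ m := fun q σ a p w h =>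
    hm ⟨(q, σ, a), by simp [h]⟩
  refine ⟨m, fun c d h => ?_⟩
  obtain ⟨a, s', p, w, hs, ⟨hδ, rfl⟩ | ⟨h', t', r', hy, hδ, rfl⟩⟩ := M.step_eq_some_iff.mp h
  all_goals
    have := key _ _ _ _ _ hδ
    simp only [hs, List.length_append, List.length_cons]
    omega

/-- The stack height of a machine halting on all inputs is linearly bounded. -/
theorem exists_linear_stk_bound [Finite Q] [Finite α] [Finite Γ] (hM : M.Valid)
    (hH : M.HaltsOnAll) :
    ∃ K, ∀ x c, M.Reaches (M.init x) c → c.stk.length ≤ K * (x.length + 3) + 1 := by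
  obtain ⟨m, hm⟩ := M.exists_push_bound
  have hbdd : ∀ k : Q × Γ, ∃ H, (∃ H', ∀ d, M.Reaches ⟨k.1, [], [k.2]⟩ d → d.stk.length ≤ H') →
      ∀ d, M.Reaches ⟨k.1, [], [k.2]⟩ d → d.stk.length ≤ H := by
    intro k
    by_cases h : ∃ H', ∀ d, M.Reaches ⟨k.1, [], [k.2]⟩ d → d.stk.length ≤ H'
    · exact ⟨h.choose, fun _ => h.choose_spec⟩
    · exact ⟨0, fun h' => absurd h' h⟩
  choose F hF using hbdd
  obtain ⟨H, hHF⟩ := (Set.finite_range F).bddAbove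
  have hpair : ∀ x q y a s, M.Reaches (M.init x) ⟨q, y, a :: s⟩ →
      ∀ d, M.Reaches ⟨q, [], [a]⟩ d → d.stk.length ≤ H := by
    intro x q y a s hx d hd
    refine (hF (q, a) ?_ d hd).trans (hHF ⟨_, rfl⟩)
    obtain ⟨h, hh, hh'⟩ := HaltsOnAll.exists_halting hH x
    have hterm := hM.step_eq_none hh'
    obtain ⟨H', hH'⟩ := (hx.of_step_eq_none hh hterm).exists_stk_bound hterm
    refine ⟨H', fun e he => ?_⟩
    have := hH' _ ((he.append_inp y).append_stk s)
    simp only [List.length_append] at this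
    omega
  have heps : ∀ x y s q c, M.Reaches (M.init x) ⟨q, y, s⟩ → M.Reaches ⟨q, y, s⟩ c → c.inp = y →
      c.stk.length ≤ s.length + H := by
    intro x y s
    induction s with
    | nil =>
      intro q c _ hc _
      rw [hc.eq_of_step_eq_none (step_nil_stk q y)]
      exact Nat.zero_le _
    | cons a s ih =>
      intro q c hx hc hcy
      rcases Reaches.split_stk (u := [a]) hc with ⟨u, hu, hr⟩ | ⟨p, y', hr, hr'⟩
      · have := hpair x q y a s hx _ (Reaches.of_append_inp (y := []) (y' := []) hr hcy)
        simp only [hu, List.length_append, List.length_cons] at this ⊢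
        omega
      · obtain rfl : y' = y := hr.inp_suffix.eq_of_length_le (hcy ▸ hr'.inp_suffix).length_le
        have := ih p c (hx.trans (hr.append_stk s)) hr' hcy
        simp only [List.length_cons]
        omega
  have main : ∀ x y q s c, M.Reaches (M.init x) ⟨q, y, s⟩ → M.Reaches ⟨q, y, s⟩ c →
      c.stk.length ≤ s.length + (H + m) * y.length + H := by
    intro x y
    induction y with
    | nil =>
      intro q s c hx hc
      simpa using heps x [] s q c hx hc (List.suffix_nil.mp hc.inp_suffix)
    | cons t r ih =>
      intro q s c hx hc
      rcases hc.eq_or_first_read with h | ⟨d, e, hd, hdy, hde, rfl, hec⟩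
      · exact (heps x _ s q c hx hc h).trans (by rw [add_right_comm]; exact Nat.le_add_right _ _)
      · have h1 := heps x _ s q d hx hd hdy
        have h2 := hm d e hde
        have h3 := ih e.st e.stk c ((hx.trans hd).tail hde) hec
        rw [List.length_cons, mul_add_one]
        omega
  refine ⟨H + m, fun x c hc => ?_⟩
  refine (main x (tape x) M.q0 [M.Z0] c .refl hc).trans ?_
  simp only [tape, List.length_cons, List.length_nil, List.length_append, List.length_map]
  nlinarith

end Height

end DPDA
section Words

/-- Every block followed by a separator. -/
def blocksThenSep (l : List (List Bool)) : List (Option Bool) :=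
  (l.map fun u => u.map some ++ [none]).flatten

/-- Every block preceded by a separator. -/
def sepThenBlocks (l : List (List Bool)) : List (Option Bool) :=
  (l.map fun u => none :: u.map some).flatten

/-- The blocks joined by single separators. -/
def joinSep (l : List (List Bool)) : List (Option Bool) :=
  (List.intersperse [none] (l.map (List.map some))).flatten

theorem joinSep_cons (u : List Bool) (l : List (List Bool)) :
    joinSep (u :: l) = u.map some ++ sepThenBlocks l := by
  induction l generalizing u with
  | nil => simp [joinSep, sepThenBlocks]
  | cons v l ih =>
    have := ih v
    simp only [joinSep, sepThenBlocks, List.map_cons, List.flatten_cons] at this ⊢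
    rw [List.intersperse_cons_cons]
    simp [this]

theorem joinSep_append_cons (l₁ l₂ : List (List Bool)) (u : List Bool) :
    joinSep (l₁ ++ u :: l₂) = blocksThenSep l₁ ++ joinSep (u :: l₂) := by
  induction l₁ with
  | nil => simp [blocksThenSep]
  | cons v l ih =>
    rw [List.cons_append, joinSep_cons]
    have : sepThenBlocks (l ++ u :: l₂) = none :: joinSep (l ++ u :: l₂) := by
      cases l <;> simp [joinSep_cons, sepThenBlocks]
    rw [this, ih]
    simp [blocksThenSep]

theorem joinSep_injOn {l l' : List (List Bool)} (hl : l ≠ []) (hl' : l' ≠ [])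
    (h : joinSep l = joinSep l') : l = l' := by
  have key : ∀ m : List (List Bool), m ≠ [] →
      (joinSep m).splitOn none = m.map (List.map some) := by
    intro m hm
    exact List.splitOn_intercalate none (by simp) (by simpa using hm)
  have := congrArg (List.splitOn none) h
  rw [key l hl, key l' hl'] at this
  exact List.map_injective_iff.mpr
    (List.map_injective_iff.mpr (Option.some_injective Bool)) this

theorem exists_joinSep_eq (s : List (Option Bool)) : ∃ l, l ≠ [] ∧ joinSep l = s := by
  induction s with
  | nil => exact ⟨[[]], by simp, by simp [joinSep]⟩
  | cons o s ih =>
    obtain ⟨l, hl, rfl⟩ := ih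
    obtain ⟨u, l, rfl⟩ := List.exists_cons_of_ne_nil hl
    rcases o with _ | b
    · exact ⟨[] :: u :: l, by simp, by simp [joinSep_cons, sepThenBlocks]⟩
    · exact ⟨(b :: u) :: l, by simp, by simp [joinSep_cons]⟩

variable {d : ℕ}

/-- The word `w₁#⋯#w_d#v₁#⋯#v_d`. -/
def hashWord (w v : Fin d → List Bool) : List (Option Bool) :=
  (List.ofFn fun i => (w i).map some ++ [(none : Option Bool)]).flatten ++
    (List.intersperse [(none : Option Bool)]
      (List.ofFn fun i => (v i).map (some : Bool → Option Bool))).flatten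

theorem hashWord_eq (w v : Fin d → List Bool) :
    hashWord w v = blocksThenSep (List.ofFn w) ++ joinSep (List.ofFn v) := by
  simp only [hashWord, blocksThenSep, joinSep, List.map_ofFn]
  rfl

theorem hashWord_eq_joinSep (hd : d ≠ 0) (w v : Fin d → List Bool) :
    hashWord w v = joinSep (List.ofFn w ++ List.ofFn v) := by
  obtain ⟨n, rfl⟩ := Nat.exists_eq_succ_of_ne_zero hd
  rw [hashWord_eq, List.ofFn_succ (f := v), joinSep_append_cons]

theorem hashWord_injective (hd : d ≠ 0) {w v w' v' : Fin d → List Bool}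
    (h : hashWord w v = hashWord w' v') : w = w' ∧ v = v' := by
  rw [hashWord_eq_joinSep hd, hashWord_eq_joinSep hd] at h
  have := joinSep_injOn (by simp [hd]) (by simp [hd]) h
  obtain ⟨h₁, h₂⟩ := List.append_inj this (by simp)
  exact ⟨List.ofFn_injective h₁, List.ofFn_injective h₂⟩

theorem mem_NPalSharp_iff {s : List (Option Bool)} :
    s ∈ NPalSharp d ↔ ∃ w v : Fin d → List Bool, (∀ i, v i ≠ (w i).reverse) ∧
      s = hashWord w v := Iff.rfl

/-- The part of `hashWord w v` before the block `w k`. -/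
def leftPart (w : Fin d → List Bool) (k : Fin d) : List (Option Bool) :=
  blocksThenSep ((List.ofFn w).take k)

/-- The part of `hashWord w v` from the block `w k` up to the block `v i`. -/
def midPart (w v : Fin d → List Bool) (k i : Fin d) : List (Option Bool) :=
  blocksThenSep ((List.ofFn w).drop k) ++ blocksThenSep ((List.ofFn v).take i)

/-- The part of `hashWord w v` after the block `v i`. -/
def rightPart (v : Fin d → List Bool) (i : Fin d) : List (Option Bool) :=
  sepThenBlocks ((List.ofFn v).drop (i + 1))

theorem hashWord_eq_parts (w v : Fin d → List Bool) (k i : Fin d) :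
    hashWord w v =
      leftPart w k ++ (midPart w v k i ++ ((v i).map some ++ rightPart v i)) := by
  have hv : List.ofFn v = (List.ofFn v).take i ++ v i :: (List.ofFn v).drop (i + 1) := by
    conv_lhs => rw [← List.take_append_drop i (List.ofFn v)]
    rw [List.drop_eq_getElem_cons (by simp)]
    simp
  have hw : blocksThenSep (List.ofFn w) =
      blocksThenSep ((List.ofFn w).take k) ++ blocksThenSep ((List.ofFn w).drop k) := by
    rw [blocksThenSep, blocksThenSep, blocksThenSep, ← List.flatten_append, ← List.map_append,
      List.take_append_drop]
  rw [hashWord_eq, hw]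
  conv_lhs => rw [hv]
  rw [joinSep_append_cons, joinSep_cons]
  simp [leftPart, midPart, rightPart]

theorem take_ofFn_congr {β : Type} {f g : Fin d → β} {k : ℕ} (h : ∀ l : Fin d, l.1 < k → f l = g l) :
    (List.ofFn f).take k = (List.ofFn g).take k := by
  apply List.ext_getElem
  · simp
  · intro n h₁ h₂
    simp only [List.length_take, List.length_ofFn, lt_min_iff] at h₁
    simpa using h ⟨n, h₁.2⟩ h₁.1

theorem drop_ofFn_congr {β : Type} {f g : Fin d → β} {k : ℕ} (h : ∀ l : Fin d, k ≤ l.1 → f l = g l) :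
    (List.ofFn f).drop k = (List.ofFn g).drop k := by
  apply List.ext_getElem
  · simp
  · intro n h₁ h₂
    simp only [List.length_drop, List.length_ofFn] at h₁
    simpa using h ⟨k + n, by omega⟩ (Nat.le_add_right _ _)

theorem leftPart_congr {w w' : Fin d → List Bool} {k : Fin d} (h : ∀ l < k, w l = w' l) :
    leftPart w k = leftPart w' k := by
  rw [leftPart, leftPart, take_ofFn_congr (g := w') fun l hl => h l hl]

theorem midPart_congr {w w' v v' : Fin d → List Bool} {k i : Fin d}
    (hw : ∀ l, k ≤ l → w l = w' l) (hv : ∀ l < i, v l = v' l) :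
    midPart w v k i = midPart w' v' k i := by
  rw [midPart, midPart, drop_ofFn_congr (g := w') fun l hl => hw l hl,
    take_ofFn_congr (g := v') fun l hl => hv l hl]

theorem rightPart_congr {v v' : Fin d → List Bool} {i : Fin d} (h : ∀ l, i < l → v l = v' l) :
    rightPart v i = rightPart v' i := by
  rw [rightPart, rightPart, drop_ofFn_congr (g := v') fun l hl => h l hl]

theorem length_hashWord_le {w v : Fin d → List Bool} {n : ℕ} (hw : ∀ i, (w i).length ≤ n)
    (hv : ∀ i, (v i).length ≤ n) : (hashWord w v).length ≤ 2 * d * (n + 1) := by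
  have hB : ∀ u : Fin d → List Bool, (∀ i, (u i).length ≤ n) →
      (blocksThenSep (List.ofFn u)).length ≤ d * (n + 1) := by
    intro u hu
    rw [blocksThenSep, List.length_flatten, List.map_map, List.map_ofFn, List.sum_ofFn]
    refine (Finset.sum_le_card_nsmul _ _ (n + 1) fun i _ => ?_).trans (by simp)
    simpa using hu i
  have hJ : (joinSep (List.ofFn v)).length ≤ (blocksThenSep (List.ofFn v)).length := by
    rcases List.eq_nil_or_concat (List.ofFn v) with h | ⟨l, u, h⟩
    · simp [h, joinSep]
    · rw [h, List.concat_eq_append, joinSep_append_cons, joinSep_cons]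
      simp [blocksThenSep, sepThenBlocks]
  rw [hashWord_eq, List.length_append]
  have := hB w hw
  have := hB v hv
  nlinarith

end Words
section Counting

variable {d : ℕ} {Q Γ : Type}

/-- The tape before the block `w k` of `hashWord w v`. -/
def leftTape (w : Fin d → List Bool) (k : Fin d) : List (TSym (Option Bool)) :=
  TSym.lend :: (leftPart w k).map TSym.ch

/-- The tape from the block `w k` up to the block `v i` of `hashWord w v`. -/
def midTape (w v : Fin d → List Bool) (k i : Fin d) : List (TSym (Option Bool)) :=
  (midPart w v k i).map TSym.ch

/-- The tape cells holding a block. -/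
def blockTape (u : List Bool) : List (TSym (Option Bool)) := (u.map some).map TSym.ch

/-- The tape after the block `v i` of `hashWord w v`. -/
def rightTape (v : Fin d → List Bool) (i : Fin d) : List (TSym (Option Bool)) :=
  (rightPart v i).map TSym.ch ++ [TSym.rend]

theorem tape_hashWord (w v : Fin d → List Bool) (k i : Fin d) :
    DPDA.tape (hashWord w v) =
      leftTape w k ++ (midTape w v k i ++ (blockTape (v i) ++ rightTape v i)) := by
  rw [hashWord_eq_parts w v k i]
  simp [DPDA.tape, leftTape, midTape, blockTape, rightTape]

/-- The reversed blocks, all of them spoilt by an additional letter except the `i`-th one. -/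
def nearReverse (b : Fin d → List Bool) (i l : Fin d) : List Bool :=
  if l = i then (b l).reverse else (b l).reverse ++ [true]

theorem nearReverse_self (b : Fin d → List Bool) (i : Fin d) :
    nearReverse b i i = (b i).reverse := if_pos rfl

theorem nearReverse_of_ne (b : Fin d → List Bool) {i l : Fin d} (h : l ≠ i) :
    nearReverse b i l = (b l).reverse ++ [true] := if_neg h

theorem nearReverse_ne_reverse {b b' : Fin d → List Bool} {i : Fin d}
    (h : ∀ l, l ≠ i → b l = b' l) (hi : b i ≠ b' i) (l : Fin d) :
    nearReverse b i l ≠ (b' l).reverse := by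
  by_cases hl : l = i
  · subst hl
    rw [nearReverse_self]
    exact fun h' => hi (List.reverse_injective h')
  · rw [nearReverse_of_ne b hl, h l hl]
    simp

namespace DPDA

variable (M : DPDA Q (Option Bool) Γ)

/-- `M` rejects the word whose `i`-th pair is the only matching one. -/
def RejectsMatch (b : Fin d → List Bool) (i : Fin d) : Prop :=
  ∃ c, M.Reaches (M.init (hashWord b (nearReverse b i))) c ∧ c.st ∈ M.Rej

open Classical in
/-- A state and a stack reached by consuming the tape prefix `A`, chosen depending on `A` only. -/
noncomputable def after (A : List (TSym (Option Bool))) : Q × List Γ :=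
  if h : ∃ r : Q × List Γ, M.Reaches ⟨M.q0, A, [M.Z0]⟩ ⟨r.1, [], r.2⟩ then h.choose
  else (M.q0, [])

variable {M}

theorem reaches_after {A : List (TSym (Option Bool))} {q : Q} {s : List Γ}
    (h : M.Reaches ⟨M.q0, A, [M.Z0]⟩ ⟨q, [], s⟩) :
    M.Reaches ⟨M.q0, A, [M.Z0]⟩ ⟨(M.after A).1, [], (M.after A).2⟩ := by
  have h' : ∃ r : Q × List Γ, M.Reaches ⟨M.q0, A, [M.Z0]⟩ ⟨r.1, [], r.2⟩ := ⟨(q, s), h⟩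
  rw [after, dif_pos h']
  exact h'.choose_spec

/-- `M` does not reject any word of `NPalSharp d`. -/
def NeverRejectsNPal (d : ℕ) (M : DPDA Q (Option Bool) Γ) : Prop :=
  ∀ w v : Fin d → List Bool, (∀ l, v l ≠ (w l).reverse) →
    ∀ c, M.Reaches (M.init (hashWord w v)) c → c.st ∉ M.Rej

variable (M) in
/-- On reading `b i` reversed, the stack returns to a part written before the block `b k`. -/
def PopsTo (b : Fin d → List Bool) (i k : Fin d) (r : Q × ℕ × ℕ) : Prop :=
  M.Reaches ⟨M.q0, leftTape b k ++
      (midTape b (nearReverse b i) k i ++ blockTape (b i).reverse), [M.Z0]⟩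
    ⟨r.1, (blockTape (b i).reverse).drop r.2.1, (M.after (leftTape b k)).2.drop r.2.2⟩

variable (M) in
/-- The symbol `a` at a lowest stack level is reached before the block `v i`, and the symbols
below it are used only after that block. -/
def Shields (b : Fin d → List Bool) (i k : Fin d) (r : Q × Γ × ℕ × Option (Q × ℕ)) : Prop :=
  ∃ B, M.Reaches ⟨M.q0, leftTape b k ++ midTape b (nearReverse b i) k i, [M.Z0]⟩
      ⟨r.1, (midTape b (nearReverse b i) k i).drop r.2.2.1, r.2.1 :: B⟩ ∧
    match r.2.2.2 with
    | none => ∃ c, M.Reaches ⟨r.1, (midTape b (nearReverse b i) k i).drop r.2.2.1 ++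
        (blockTape (b i).reverse ++ rightTape (nearReverse b i) i), [r.2.1]⟩ c ∧ c.st ∈ M.Rej
    | some (p, e) => M.Reaches ⟨r.1, (midTape b (nearReverse b i) k i).drop r.2.2.1 ++
        (blockTape (b i).reverse ++ rightTape (nearReverse b i) i), [r.2.1]⟩
          ⟨p, (rightTape (nearReverse b i) i).drop e, []⟩ ∧
        ∃ c, M.Reaches ⟨p, (rightTape (nearReverse b i) i).drop e, B⟩ c ∧ c.st ∈ M.Rej

theorem PopsTo.eq {b b' : Fin d → List Bool} {i k : Fin d} {r : Q × ℕ × ℕ} (hik : i < k)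
    (hM : M.Valid) (hN : NeverRejectsNPal d M) (hb : M.PopsTo b i k r) (hb' : M.PopsTo b' i k r)
    (hr : M.RejectsMatch b k) (h : ∀ l, l ≠ k → b l = b' l) : b = b' := by
  by_contra hne
  have hk : b k ≠ b' k := fun hk => hne (funext fun l => by
    by_cases hl : l = k
    · rw [hl, hk]
    · exact h l hl)
  obtain ⟨c, hc, hcr⟩ := hr
  have hleft : leftTape b' k = leftTape b k := by
    rw [leftTape, leftTape, leftPart_congr fun l hl => (h l hl.ne).symm]
  have hmid : midTape b' (nearReverse b k) k i = midTape b' (nearReverse b' i) k i := by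
    rw [midTape, midTape, midPart_congr (fun _ _ => rfl) fun l hl => ?_]
    rw [nearReverse_of_ne _ (hl.trans hik).ne, nearReverse_of_ne _ hl.ne, h l (hl.trans hik).ne]
  have hmid' : midTape b (nearReverse b k) k i = midTape b (nearReverse b i) k i := by
    rw [midTape, midTape, midPart_congr (fun _ _ => rfl) fun l hl => ?_]
    rw [nearReverse_of_ne _ (hl.trans hik).ne, nearReverse_of_ne _ hl.ne]
  have hblock : blockTape (nearReverse b k i) =
      blockTape (b i).reverse ++ [TSym.ch (some true)] := by
    rw [nearReverse_of_ne _ hik.ne]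
    simp [blockTape]
  have h₁ := hb.append_inp ([TSym.ch (some true)] ++ rightTape (nearReverse b k) i)
  have h₂ := hb'.append_inp ([TSym.ch (some true)] ++ rightTape (nearReverse b k) i)
  rw [init, tape_hashWord _ _ k i, hblock, hmid'] at hc
  simp only [List.append_assoc] at hc h₁ h₂
  refine hN b' (nearReverse b k) (nearReverse_ne_reverse h hk) c ?_ hcr
  rw [init, tape_hashWord _ _ k i, hblock, hmid, List.append_assoc, ]
  have h₃ := h₁.of_step_eq_none hc (hM.step_eq_none (.inr hcr))
  rw [hleft, ← h i hik.ne] at h₂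
  rw [hleft]
  exact h₂.trans h₃

theorem Shields.eq {b b' : Fin d → List Bool} {i k : Fin d} {r : Q × Γ × ℕ × Option (Q × ℕ)}
    (hik : i < k) (hN : NeverRejectsNPal d M) (hb : M.Shields b i k r)
    (hb' : M.Shields b' i k r) (h : ∀ l, l ≠ i → b l = b' l) : b = b' := by
  by_contra hne
  have hi : b i ≠ b' i := fun hi => hne (funext fun l => by
    by_cases hl : l = i
    · rw [hl, hi]
    · exact h l hl)
  have hmid : midTape b' (nearReverse b' i) k i = midTape b (nearReverse b' i) k i := by
    rw [midTape, midTape, midPart_congr (fun l hl => (h l (hik.trans_le hl).ne').symm)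
      fun _ _ => rfl]
  have hmid' : midTape b (nearReverse b i) k i = midTape b (nearReverse b' i) k i := by
    rw [midTape, midTape, midPart_congr (fun _ _ => rfl) fun l hl => ?_]
    rw [nearReverse_of_ne _ hl.ne, nearReverse_of_ne _ hl.ne, h l hl.ne]
  have hright : rightTape (nearReverse b i) i = rightTape (nearReverse b' i) i := by
    rw [rightTape, rightTape, rightPart_congr fun l hl => ?_]
    rw [nearReverse_of_ne _ hl.ne', nearReverse_of_ne _ hl.ne', h l hl.ne']
  have hnm : ∀ l, nearReverse b' i l ≠ (b l).reverse :=
    nearReverse_ne_reverse (fun l hl => (h l hl).symm) hi.symm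
  obtain ⟨p, a, m, o⟩ := r
  obtain ⟨B, hB, hbo⟩ := hb
  obtain ⟨B', -, hbo'⟩ := hb'
  simp only [hmid, hmid', hright] at hB hbo hbo'
  have key := hN b (nearReverse b' i) hnm
  rw [init, tape_hashWord _ _ k i, nearReverse_self] at key
  have h₁ := hB.append_inp (blockTape (b' i).reverse ++ rightTape (nearReverse b' i) i)
  simp only [List.append_assoc] at h₁
  rcases o with _ | ⟨p', e⟩
  · obtain ⟨c, hc, hcr⟩ := hbo'
    exact key _ (h₁.trans (hc.append_stk B)) hcr
  · obtain ⟨-, c, hc, hcr⟩ := hbo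
    exact key c ((h₁.trans (hbo'.1.append_stk B)).trans hc) hcr

theorem RejectsMatch.popsTo_or_shields {b : Fin d → List Bool} {i k : Fin d}
    (hM : M.Valid) (hN : NeverRejectsNPal d M) (hr : M.RejectsMatch b i) {K : ℕ}
    (hK : ∀ x c, M.Reaches (M.init x) c → c.stk.length ≤ K * (x.length + 3) + 1) {L : ℕ}
    (hL : (K + 1) * ((hashWord b (nearReverse b i)).length + 3) + 1 < L) :
    (∃ r : Q × Fin L × Fin L, M.PopsTo b i k (r.1, r.2.1, r.2.2)) ∨
      ∃ r : Q × Γ × Fin L × Option (Q × Fin L),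
        M.Shields b i k (r.1, r.2.1, r.2.2.1, r.2.2.2.map fun s => (s.1, s.2.1)) := by
  obtain ⟨c, hc, hcr⟩ := hr
  have hlen : (leftTape b k ++ (midTape b (nearReverse b i) k i ++
      (blockTape (b i).reverse ++ rightTape (nearReverse b i) i))).length < L := by
    have := congrArg List.length (tape_hashWord b (nearReverse b i) k i)
    rw [nearReverse_self] at this
    rw [← this]
    simp only [tape, List.length_cons, List.length_append, List.length_map, List.length_nil]
    nlinarith
  have hterm := hM.step_eq_none (.inr hcr)
  -- no rejection occurs before the block `v i` is read
  have hearly : ∀ c', M.Reaches ⟨M.q0, leftTape b k ++ midTape b (nearReverse b i) k i, [M.Z0]⟩ c' →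
      c'.st ∉ M.Rej := by
    intro c' hc' hcr'
    refine hN b (fun l => (b l).reverse ++ [true]) (by simp)
      ⟨c'.st, c'.inp ++ (blockTape ((b i).reverse ++ [true]) ++
        rightTape (fun l => (b l).reverse ++ [true]) i), c'.stk⟩ ?_ hcr'
    rw [init, tape_hashWord _ _ k i, ← List.append_assoc]
    have : midTape b (nearReverse b i) k i =
        midTape b (fun l => (b l).reverse ++ [true]) k i := by
      rw [midTape, midTape, midPart_congr (fun _ _ => rfl) fun l hl => ?_]
      rw [nearReverse_of_ne _ hl.ne]
    rw [this] at hc'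
    exact hc'.append_inp _
  obtain ⟨q, s, hqs⟩ : ∃ q s, M.Reaches ⟨M.q0, leftTape b k, [M.Z0]⟩ ⟨q, [], s⟩ := by
    rw [init, tape_hashWord _ _ k i] at hc
    rcases hc.split_inp with ⟨y', -, hy'⟩ | ⟨q', s', h, -⟩
    · exact absurd hcr (hearly ⟨c.st, y' ++ _, c.stk⟩ (hy'.append_inp _))
    · exact ⟨q', s', h⟩
  have ha := reaches_after hqs
  have hs : (M.after (leftTape b k)).2.length < L := by
    have hx := hK (hashWord b (nearReverse b i))
    rw [init, tape_hashWord _ _ k i] at hx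
    have := hx _ (ha.append_inp _)
    simp only at this
    nlinarith
  rw [init, tape_hashWord _ _ k i, nearReverse_self] at hc
  have ha' := (ha.append_inp _).of_step_eq_none hc hterm
  simp only [List.nil_append] at ha'
  simp only [List.length_append] at hlen
  rcases reject_dichotomy ha' hM hcr fun c' hc' =>
      hearly c' (((ha.append_inp _).trans hc')) with
    ⟨p, D', B, hD', hB, h⟩ | ⟨p, C', a, B, hC', h, h'⟩
  · left
    rw [List.suffix_iff_eq_drop] at hD' hB
    refine ⟨(p, ⟨(blockTape (b i).reverse).length - D'.length, by omega⟩,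
      ⟨(M.after (leftTape b k)).2.length - B.length, by omega⟩), ?_⟩
    rw [PopsTo]
    simp only [← hD', ← hB]
    exact (ha.append_inp _).trans h
  · right
    rw [List.suffix_iff_eq_drop] at hC'
    have h₁ := (ha.append_inp (midTape b (nearReverse b i) k i)).trans h
    rcases h' with h' | ⟨p', E', hE', h', h''⟩
    · refine ⟨(p, a, ⟨(midTape b (nearReverse b i) k i).length - C'.length, by omega⟩, none),
        B, ?_⟩
      simp only [← hC', Option.map_none]
      exact ⟨h₁, h'⟩
    · rw [List.suffix_iff_eq_drop] at hE'
      refine ⟨(p, a, ⟨(midTape b (nearReverse b i) k i).length - C'.length, by omega⟩,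
        some (p', ⟨(rightTape (nearReverse b i) i).length - E'.length, by omega⟩)), B, ?_⟩
      simp only [← hC', Option.map_some, ← hE']
      exact ⟨h₁, h', h''⟩

end DPDA

/-- A set of tuples whose members are determined by a label and the entries off `k`. -/
theorem card_le_of_labels {W δ : Type} [Fintype W] [Fintype δ] (k : Fin d)
    (S : Finset (Fin d → W)) (R : (Fin d → W) → δ → Prop) (hex : ∀ b ∈ S, ∃ x, R b x)
    (hinj : ∀ b ∈ S, ∀ b' ∈ S, ∀ x, R b x → R b' x → (∀ l, l ≠ k → b l = b' l) → b = b') :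
    S.card ≤ Fintype.card W ^ (d - 1) * Fintype.card δ := by
  classical
  rcases S.eq_empty_or_nonempty with rfl | ⟨b₀, hb₀⟩
  · simp
  have : Nonempty δ := ⟨(hex b₀ hb₀).choose⟩
  choose! f hf using hex
  calc S.card ≤ (Finset.univ : Finset (({l : Fin d // l ≠ k} → W) × δ)).card :=
        Finset.card_le_card_of_injOn (fun b => (fun l => b l.1, f b)) (by simp) ?_
    _ = _ := by simp [Fintype.card_subtype_compl]
  intro b hb b' hb' h
  obtain ⟨h₁, h₂⟩ := Prod.mk.inj h
  exact hinj b hb b' hb' (f b) (hf b hb) (h₂ ▸ hf b' hb') fun l hl => congrFun h₁ ⟨l, hl⟩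

/-- A machine rejects only few words with one matching pair at `i` and at `k` simultaneously. -/
theorem DPDA.card_rejectsMatch_le [Fintype Q] [Fintype Γ] {M : DPDA Q (Option Bool) Γ}
    (hM : M.Valid) (hH : M.HaltsOnAll) (hN : DPDA.NeverRejectsNPal d M) :
    ∃ K, ∀ (n : ℕ) (i k : Fin d), i < k → ∀ S : Finset (Fin d → List.Vector Bool n),
      (∀ b ∈ S, M.RejectsMatch (fun l => (b l).toList) i ∧
        M.RejectsMatch (fun l => (b l).toList) k) →
      S.card ≤ (2 ^ n) ^ (d - 1) * (K * (n + 1) ^ 2) := by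
  classical
  obtain ⟨K, hK⟩ := DPDA.exists_linear_stk_bound hM hH
  set T := (K + 1) * (4 * d + 3) + 2 with hT
  refine ⟨(Fintype.card Q + Fintype.card Q * Fintype.card Γ * (Fintype.card Q + 1)) * T ^ 2, ?_⟩
  intro n i k hik S hS
  set L := T * (n + 1) with hLdef
  have htoList : ∀ b b' : Fin d → List.Vector Bool n,
      (fun l => (b l).toList) = (fun l => (b' l).toList) → b = b' := fun b b' h =>
    funext fun l => List.Vector.toList_injective (congrFun h l)
  have hL : ∀ b : Fin d → List.Vector Bool n, (K + 1) * ((hashWord (fun l => (b l).toList)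
      (nearReverse (fun l => (b l).toList) i)).length + 3) + 1 < L := by
    intro b
    have : (hashWord (fun l => (b l).toList)
        (nearReverse (fun l => (b l).toList) i)).length ≤ 2 * d * (n + 1 + 1) := by
      apply length_hashWord_le
      · simp
      · intro l
        rw [nearReverse]
        split_ifs <;> simp
    calc _ ≤ (K + 1) * (2 * d * (n + 1 + 1) + 3) + 1 := by gcongr
      _ < L := by
        have : (K + 1) * (2 * d * (n + 1 + 1) + 3) ≤ (K + 1) * ((4 * d + 3) * (n + 1)) := by
          gcongr
          nlinarith [Nat.zero_le (d * n)]
        have hexp : L = (K + 1) * ((4 * d + 3) * (n + 1)) + 2 * (n + 1) := by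
          rw [hLdef, hT]
          ring
        omega
  have hLpos : 1 ≤ L := Nat.mul_pos (by omega) (by omega)
  set S₁ := S.filter fun b => ∃ r : Q × Fin L × Fin L,
    M.PopsTo (fun l => (b l).toList) i k (r.1, r.2.1, r.2.2) with hS₁
  set S₂ := S.filter fun b => ∃ r : Q × Γ × Fin L × Option (Q × Fin L),
    M.Shields (fun l => (b l).toList) i k
      (r.1, r.2.1, r.2.2.1, r.2.2.2.map fun s => (s.1, s.2.1)) with hS₂
  have hsub : S ⊆ S₁ ∪ S₂ := by
    intro b hb
    rw [hS₁, hS₂, ← Finset.filter_or, Finset.mem_filter]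
    exact ⟨hb, (hS b hb).1.popsTo_or_shields hM hN hK (hL b)⟩
  have h₁ : S₁.card ≤ (2 ^ n) ^ (d - 1) * (Fintype.card Q * L ^ 2) := by
    refine (card_le_of_labels k S₁ (fun b (r : Q × Fin L × Fin L) =>
      M.PopsTo (fun l => (b l).toList) i k (r.1, r.2.1, r.2.2))
      (fun b hb => (Finset.mem_filter.mp hb).2) ?_).trans ?_
    · intro b hb b' _ r hr hr' h
      exact htoList b b' (hr.eq hik hM hN hr' (hS b (Finset.mem_filter.mp hb).1).2
        fun l hl => by rw [h l hl])
    · simp [sq]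
  have h₂ : S₂.card ≤ (2 ^ n) ^ (d - 1) *
      (Fintype.card Q * Fintype.card Γ * (Fintype.card Q + 1) * L ^ 2) := by
    refine (card_le_of_labels i S₂ (fun b (r : Q × Γ × Fin L × Option (Q × Fin L)) =>
      M.Shields (fun l => (b l).toList) i k
        (r.1, r.2.1, r.2.2.1, r.2.2.2.map fun s => (s.1, s.2.1)))
      (fun b hb => (Finset.mem_filter.mp hb).2) ?_).trans ?_
    · intro b _ b' _ r hr hr' h
      exact htoList b b' (hr.eq hik hN hr' fun l hl => by rw [h l hl])
    · simp only [card_vector, Fintype.card_bool, Fintype.card_prod, Fintype.card_fin,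
        Fintype.card_option]
      refine Nat.mul_le_mul_left _ ?_
      calc _ = Fintype.card Q * Fintype.card Γ * L * (Fintype.card Q * L + 1) := by ring
        _ ≤ Fintype.card Q * Fintype.card Γ * L * (Fintype.card Q * L + L) := by gcongr
        _ = _ := by ring
  calc S.card ≤ S₁.card + S₂.card :=
        (Finset.card_le_card hsub).trans (Finset.card_union_le _ _)
    _ ≤ _ := add_le_add h₁ h₂
    _ = _ := by rw [hLdef]; ring

end Counting
section LowerBound

variable {d : ℕ} {Q Γ : Type}

theorem DPDA.Valid.not_accepts_of_reaches_rej {α : Type} {M : DPDA Q α Γ} (hM : M.Valid)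
    {x : List α} {c : Cfg Q α Γ} (hc : M.Reaches (M.init x) c) (hr : c.st ∈ M.Rej) :
    x ∉ M.lang := by
  rintro ⟨n, e, he, ha⟩
  have he' : M.Reaches (M.init x) e := (M.reaches_iff_stepN).2 ⟨n, he⟩
  have h₁ := hc.of_step_eq_none he' (hM.step_eq_none (Or.inl ha))
  have h₂ := h₁.eq_of_step_eq_none (hM.step_eq_none (Or.inr hr))
  subst h₂
  exact hM.1 _ ha hr

theorem IsDCFL.card_notMem_le {L : Set (List (Option Bool))} (hL : IsDCFL L)
    (hsub : NPalSharp d ⊆ L) : ∃ K, ∀ n (i k : Fin d), i < k →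
      ∀ S : Finset (Fin d → List.Vector Bool n),
        (∀ b ∈ S, hashWord (fun l => (b l).toList) (nearReverse (fun l => (b l).toList) i) ∉ L ∧
          hashWord (fun l => (b l).toList) (nearReverse (fun l => (b l).toList) k) ∉ L) →
        S.card ≤ (2 ^ n) ^ (d - 1) * (K * (n + 1) ^ 2) := by
  obtain ⟨Q, Γ, _, _, M, hM, hH, rfl⟩ := hL
  have hN : M.NeverRejectsNPal d := fun w v hwv c hc hr =>
    hM.not_accepts_of_reaches_rej hc hr (hsub (mem_NPalSharp_iff.2 ⟨w, v, hwv, rfl⟩))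
  have hrej : ∀ (b : Fin d → List Bool) i, hashWord b (nearReverse b i) ∉ M.lang →
      M.RejectsMatch b i := by
    intro b i h
    obtain ⟨c, hc, ha | hr⟩ := hH.exists_halting (hashWord b (nearReverse b i))
    · obtain ⟨n, hn⟩ := (M.reaches_iff_stepN).1 hc
      exact absurd ⟨n, c, hn, ha⟩ h
    · exact ⟨c, hc, hr⟩
  obtain ⟨K, hK⟩ := DPDA.card_rejectsMatch_le hM hH hN
  exact ⟨K, fun n i k hik S hS =>
    hK n i k hik S fun b hb => ⟨hrej _ _ (hS b hb).1, hrej _ _ (hS b hb).2⟩⟩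

theorem exists_mul_sq_lt_two_pow (T : ℕ) : ∃ n, T * (n + 1) ^ 2 < 2 ^ n := by
  have h := tendsto_pow_const_div_const_pow_of_one_lt 2 (r := (2 : ℝ)) one_lt_two
  have h' := (h.comp (Filter.tendsto_add_atTop_nat 1)).eventually
    (gt_mem_nhds (show (0 : ℝ) < 1 / (2 * (T + 1)) by positivity))
  obtain ⟨n, hn⟩ := h'.exists
  refine ⟨n, ?_⟩
  simp only [Function.comp_apply] at hn
  rw [div_lt_div_iff₀ (by positivity) (by positivity), pow_succ (2 : ℝ)] at hn
  have : (T : ℝ) * (n + 1) ^ 2 < 2 ^ n := by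
    push_cast at hn
    nlinarith [sq_nonneg ((n : ℝ) + 1)]
  exact_mod_cast this

open Classical in
theorem not_DCFLInter_NPalSharp (hd : 2 ≤ d) : ¬ DCFLInter (d - 1) (NPalSharp d) := by
  rintro ⟨f, hf, hL⟩
  have hsub : ∀ j, NPalSharp d ⊆ f j := fun j => hL ▸ Set.iInter_subset f j
  choose K hK using fun j => (hf j).card_notMem_le (hsub j)
  let T := ∑ p : Fin d × Fin d × Fin (d - 1), K p.2.2
  obtain ⟨n, hn⟩ := exists_mul_sq_lt_two_pow T
  let x : (Fin d → List.Vector Bool n) → Fin d → List (Option Bool) := fun b i =>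
    hashWord (fun l => (b l).toList) (nearReverse (fun l => (b l).toList) i)
  let S : Fin d × Fin d × Fin (d - 1) → Finset (Fin d → List.Vector Bool n) := fun p =>
    Finset.univ.filter fun b => p.1 < p.2.1 ∧ x b p.1 ∉ f p.2.2 ∧ x b p.2.1 ∉ f p.2.2
  have hcov : (Finset.univ : Finset (Fin d → List.Vector Bool n)) ⊆ Finset.univ.biUnion S := by
    intro b _
    have hx : ∀ i, ∃ j, x b i ∉ f j := by
      intro i
      by_contra! h
      obtain ⟨w, v, hwv, he⟩ := mem_NPalSharp_iff.1 (hL ▸ Set.mem_iInter.2 h : x b i ∈ NPalSharp d)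
      obtain ⟨rfl, rfl⟩ := hashWord_injective (by omega) he
      exact hwv i (nearReverse_self _ i)
    choose g hg using hx
    obtain ⟨i, k, hne, he⟩ := Fintype.exists_ne_map_eq_of_card_lt g (by simp; omega)
    simp only [Finset.mem_biUnion, Finset.mem_univ, true_and]
    rcases lt_or_gt_of_ne hne with h | h
    · exact ⟨(i, k, g i), by simp [S, h, hg i, he ▸ hg k]⟩
    · exact ⟨(k, i, g i), by simp [S, h, hg i, he ▸ hg k]⟩
  have hcard : ∀ p, (S p).card ≤ (2 ^ n) ^ (d - 1) * (K p.2.2 * (n + 1) ^ 2) := by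
    intro p
    by_cases hp : p.1 < p.2.1
    · exact hK p.2.2 n p.1 p.2.1 hp (S p) fun b hb => (Finset.mem_filter.1 hb).2.2
    · simp [S, hp]
  have htot : (2 ^ n) ^ d ≤ (2 ^ n) ^ (d - 1) * (T * (n + 1) ^ 2) := by
    have h₁ := (Finset.card_le_card hcov).trans Finset.card_biUnion_le
    rw [Finset.card_univ, Fintype.card_fun, Fintype.card_fin, card_vector, Fintype.card_bool] at h₁
    refine h₁.trans ((Finset.sum_le_sum fun p _ => hcard p).trans_eq ?_)
    rw [← Finset.mul_sum, ← Finset.sum_mul]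
  have hpow : (2 ^ n) ^ d = (2 ^ n) ^ (d - 1) * 2 ^ n := by
    rw [← pow_succ, Nat.sub_add_cancel (by omega)]
  rw [hpow] at htot
  exact absurd (Nat.le_of_mul_le_mul_left htot (by positivity)) (not_le.2 hn)

end LowerBound

section UpperBound

/-- The value computed by `blockComparer n i j` in the `c`-th block, with `fl` telling whether a
mismatch has been found, with the bits `s` on the stack and the word `x` still to be read. -/
def compareFrom (n i j : ℕ) : ℕ → Bool → List Bool → List (Option Bool) → Bool
  | c, fl, s, [] => decide (c = n) && (fl || (decide (c = j) && !s.isEmpty))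
  | c, fl, s, none :: x =>
    if c < n then compareFrom n i j (c + 1) (fl || (decide (c = j) && !s.isEmpty)) s x else false
  | c, fl, s, some b :: x =>
    if c = i then compareFrom n i j c fl (b :: s) x
    else if c = j ∧ fl = false then
      match s with
      | [] => compareFrom n i j c true [] x
      | a :: s => if a = b then compareFrom n i j c false s x
        else compareFrom n i j c true (a :: s) x
    else compareFrom n i j c fl s x

/-- The automaton comparing the `j`-th block of an input of `n + 1` blocks with the reverse of the
`i`-th one, which is kept on the stack above the bottom marker `none`. -/
def blockComparer (n i j : ℕ) :
    DPDA (Bool ⊕ Option (Fin (n + 1) × Bool)) (Option Bool) (Option Bool) where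
  δ
    | .inl _, _, _ => none
    | .inr _, none, _ => none
    | .inr none, some .lend, a => some (.inr (some (0, false)), [a])
    | .inr none, some _, a => some (.inl false, [a])
    | .inr (some _), some .lend, a => some (.inl false, [a])
    | .inr (some (c, fl)), some .rend, a =>
      some (.inl (decide (c.1 = n) && (fl || (decide (c.1 = j) && a.isSome))), [a])
    | .inr (some (c, fl)), some (.ch none), a =>
      if h : c.1 < n then
        some (.inr (some (⟨c + 1, by omega⟩, fl || (decide (c.1 = j) && a.isSome))), [a])
      else some (.inl false, [a])
    | .inr (some (c, fl)), some (.ch (some b)), a =>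
      if c.1 = i then some (.inr (some (c, fl)), [some b, a])
      else if c.1 = j ∧ fl = false then
        if a = some b then some (.inr (some (c, false)), []) else some (.inr (some (c, true)), [a])
      else some (.inr (some (c, fl)), [a])
  q0 := .inr none
  Z0 := none
  Acc := {.inl true}
  Rej := {.inl false}

variable {n i j : ℕ}

theorem blockComparer_isHalting_iff {q : Bool ⊕ Option (Fin (n + 1) × Bool)} :
    (blockComparer n i j).IsHalting q ↔ ∃ a, q = .inl a := by
  simp [DPDA.IsHalting, blockComparer, or_comm]

theorem blockComparer_valid : (blockComparer n i j).Valid := by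
  refine ⟨?_, ?_, ?_, ?_⟩
  · rintro q rfl h
    simp [blockComparer] at h
  · intro q hq σ a
    obtain ⟨b, rfl⟩ := blockComparer_isHalting_iff.1 hq
    rfl
  · rintro (b | _ | ⟨c, fl⟩) hq σ a
    · exact absurd (blockComparer_isHalting_iff.2 ⟨b, rfl⟩) hq
    · rcases σ with _ | _ | _ <;> simp [blockComparer]
    · rcases σ with _ | _ | _ | b
      · simp [blockComparer]
      · simp [blockComparer]
      · simp only [blockComparer]
        split_ifs <;> simp
      · simp only [blockComparer]
        split_ifs <;> simp
  · rintro (b | _ | ⟨c, fl⟩) (_ | _ | _ | _ | b) p w h <;>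
      simp only [blockComparer] at h <;> grind

theorem blockComparer_reaches (c : Fin (n + 1)) (fl : Bool) (s : List Bool)
    (x : List (Option Bool)) : ∃ t r, (blockComparer n i j).Reaches
      ⟨.inr (some (c, fl)), x.map TSym.ch ++ [TSym.rend], s.map some ++ [none]⟩
      ⟨.inl (compareFrom n i j c fl s x), t, r⟩ := by
  induction x generalizing c fl s with
  | nil =>
    refine ⟨[], s.map some ++ [none], .single ?_⟩
    cases s <;> simp [DPDA.step, blockComparer, compareFrom]
  | cons o x ih =>
    have step_to : ∀ (c' : Fin (n + 1)) fl' s',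
        (blockComparer n i j).step ⟨.inr (some (c, fl)), (o :: x).map TSym.ch ++ [TSym.rend],
          s.map some ++ [none]⟩ =
          some ⟨.inr (some (c', fl')), x.map TSym.ch ++ [TSym.rend], s'.map some ++ [none]⟩ →
        compareFrom n i j c fl s (o :: x) = compareFrom n i j c' fl' s' x →
        ∃ t r, (blockComparer n i j).Reaches
          ⟨.inr (some (c, fl)), (o :: x).map TSym.ch ++ [TSym.rend], s.map some ++ [none]⟩
          ⟨.inl (compareFrom n i j c fl s (o :: x)), t, r⟩ := by
      intro c' fl' s' h he
      obtain ⟨t, r, htr⟩ := ih c' fl' s'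
      exact ⟨t, r, he ▸ Relation.ReflTransGen.head h htr⟩
    rcases o with _ | b
    · by_cases hc : c.1 < n
      · refine step_to ⟨c + 1, by omega⟩ (fl || (decide (c.1 = j) && !s.isEmpty)) s ?_ ?_
        · cases s <;> simp [DPDA.step, blockComparer, hc]
        · simp [compareFrom, hc]
      · refine ⟨x.map TSym.ch ++ [TSym.rend], s.map some ++ [none], .single ?_⟩
        cases s <;> simp [DPDA.step, blockComparer, compareFrom, hc]
    · by_cases hi : c.1 = i
      · refine step_to c fl (b :: s) ?_ ?_
        · cases s <;> simp [DPDA.step, blockComparer, hi]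
        · simp [compareFrom, hi]
      by_cases hj : c.1 = j ∧ fl = false
      · have hji : j ≠ i := hj.1 ▸ hi
        rcases s with _ | ⟨a, s⟩
        · refine step_to c true [] ?_ ?_ <;>
            simp [DPDA.step, blockComparer, compareFrom, hji, hj]
        · by_cases hab : a = b
          · refine step_to c false s ?_ ?_
            · simp [DPDA.step, blockComparer, hji, hj, hab]
            · simp [compareFrom, hji, hj, hab]
          · refine step_to c true (a :: s) ?_ ?_
            · simp [DPDA.step, blockComparer, hji, hj, hab]
            · simp [compareFrom, hji, hj, hab]
      · refine step_to c fl s ?_ ?_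
        · cases s <;> simp [DPDA.step, blockComparer, hi, hj]
        · simp [compareFrom, hi, hj]

theorem isDCFL_compareFrom (n i j : ℕ) : IsDCFL {x | compareFrom n i j 0 false [] x = true} := by
  have hreach : ∀ x, ∃ t r, (blockComparer n i j).Reaches ((blockComparer n i j).init x)
      ⟨.inl (compareFrom n i j 0 false [] x), t, r⟩ := by
    intro x
    obtain ⟨t, r, h⟩ := blockComparer_reaches (i := i) (j := j) (0 : Fin (n + 1)) false [] x
    exact ⟨t, r, .head rfl h⟩
  refine ⟨_, _, inferInstance, inferInstance, blockComparer n i j, blockComparer_valid, ?_, ?_⟩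
  · intro x
    obtain ⟨t, r, h⟩ := hreach x
    obtain ⟨k, hk⟩ := (DPDA.reaches_iff_stepN _).1 h
    exact ⟨k, _, hk, blockComparer_isHalting_iff.2 ⟨_, rfl⟩⟩
  · ext x
    obtain ⟨t, r, h⟩ := hreach x
    constructor
    · intro hx
      obtain ⟨k, hk⟩ := (DPDA.reaches_iff_stepN _).1 h
      exact ⟨k, _, hk, congrArg Sum.inl hx⟩
    · intro hx
      by_contra hx'
      refine blockComparer_valid.not_accepts_of_reaches_rej h ?_ hx
      exact congrArg Sum.inl (Bool.eq_false_iff.2 hx')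

theorem joinSep_cons_cons (u v : List Bool) (l : List (List Bool)) :
    joinSep (u :: v :: l) = u.map some ++ none :: joinSep (v :: l) := by
  simp [joinSep_cons, sepThenBlocks]

theorem compareFrom_push (fl : Bool) (s u : List Bool) (x : List (Option Bool)) :
    compareFrom n i j i fl s (u.map some ++ x) = compareFrom n i j i fl (u.reverse ++ s) x := by
  induction u generalizing s with
  | nil => rfl
  | cons b u ih => simp [compareFrom, ih]

theorem compareFrom_skip {c : ℕ} {fl : Bool} (hi : c ≠ i) (hj : ¬ (c = j ∧ fl = false))
    (s u : List Bool) (x : List (Option Bool)) :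
    compareFrom n i j c fl s (u.map some ++ x) = compareFrom n i j c fl s x := by
  induction u with
  | nil => rfl
  | cons b u ih => simp [compareFrom, ih, hi, hj]

theorem exists_compareFrom_pop (hij : j ≠ i) (s u : List Bool) (x : List (Option Bool)) :
    ∃ fl s', (fl || !s'.isEmpty) = decide (u ≠ s) ∧
      compareFrom n i j j false s (u.map some ++ x) = compareFrom n i j j fl s' x := by
  induction u generalizing s with
  | nil => exact ⟨false, s, by cases s <;> simp, rfl⟩
  | cons b u ih =>
    rcases s with _ | ⟨a, s⟩
    · refine ⟨true, [], by simp, ?_⟩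
      simp [compareFrom, hij, compareFrom_skip hij (fl := true)]
    · by_cases hab : a = b
      · obtain ⟨fl, s', h, h'⟩ := ih s
        refine ⟨fl, s', by simp [h, hab], ?_⟩
        rw [← h']
        simp [compareFrom, hij, hab]
      · refine ⟨true, a :: s, by simp [Ne.symm hab], ?_⟩
        simp [compareFrom, hij, hab, compareFrom_skip hij (fl := true)]

theorem compareFrom_joinSep_of_gt (hij : i < j) {c : ℕ} (hc : j < c) (hcn : c ≤ n) (fl : Bool)
    (s u : List Bool) (l : List (List Bool)) :
    compareFrom n i j c fl s (joinSep (u :: l)) = true ↔ c + l.length = n ∧ fl = true := by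
  induction l generalizing c u with
  | nil =>
    rw [joinSep_cons, compareFrom_skip (by omega) (by omega)]
    simp [sepThenBlocks, compareFrom, hc.ne']
  | cons v l ih =>
    rw [joinSep_cons_cons, compareFrom_skip (by omega) (by omega), compareFrom]
    split_ifs with h
    · simp only [hc.ne', decide_false, Bool.false_and, Bool.or_false]
      rw [ih (c := c + 1) (by omega) h, List.length_cons]
      exact and_congr_left fun _ => by omega
    · simp
      omega

theorem compareFrom_joinSep_self (hij : i < j) (hjn : j ≤ n) (s u : List Bool)
    (l : List (List Bool)) :
    compareFrom n i j j false s (joinSep (u :: l)) = true ↔ j + l.length = n ∧ u ≠ s := by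
  rcases l with _ | ⟨v, l⟩
  · obtain ⟨fl, s', h, h'⟩ := exists_compareFrom_pop (n := n) hij.ne' s u []
    rw [joinSep_cons, sepThenBlocks, List.map_nil, List.flatten_nil, h']
    simp [compareFrom, h]
  · obtain ⟨fl, s', h, h'⟩ := exists_compareFrom_pop (n := n) hij.ne' s u (none :: joinSep (v :: l))
    rw [joinSep_cons_cons, h', compareFrom]
    split_ifs with hn
    · rw [compareFrom_joinSep_of_gt hij (by omega) hn]
      simp [h]
      omega
    · simp
      omega

theorem compareFrom_joinSep_between (hjn : j ≤ n) {c : ℕ} (hic : i < c) (hcj : c ≤ j)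
    (s u : List Bool) (l : List (List Bool)) :
    compareFrom n i j c false s (joinSep (u :: l)) = true ↔
      c + l.length = n ∧ (u :: l)[j - c]? ≠ some s := by
  induction l generalizing c u with
  | nil =>
    rcases hcj.eq_or_lt with rfl | hcj
    · simp [compareFrom_joinSep_self hic hjn]
    · rw [joinSep_cons, compareFrom_skip (by omega) (by omega)]
      simp [sepThenBlocks, compareFrom]
      omega
  | cons v l ih =>
    rcases hcj.eq_or_lt with rfl | hcj
    · simp [compareFrom_joinSep_self hic hjn]
    · rw [joinSep_cons_cons, compareFrom_skip (by omega) (by omega), compareFrom,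
        if_pos (by omega)]
      simp only [hcj.ne, decide_false, Bool.false_and, Bool.false_or]
      rw [ih (by omega) (by omega), show j - c = j - (c + 1) + 1 by omega,
        List.getElem?_cons_succ, List.length_cons]
      refine and_congr_left fun _ => by omega

theorem compareFrom_joinSep (hij : i < j) (hjn : j ≤ n) {c : ℕ} (hci : c ≤ i) (u : List Bool)
    (l : List (List Bool)) :
    compareFrom n i j c false [] (joinSep (u :: l)) = true ↔
      c + l.length = n ∧ (u :: l)[j - c]? ≠ ((u :: l)[i - c]?).map List.reverse := by
  induction l generalizing c u with
  | nil =>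
    have : c ≠ n := by omega
    rcases hci.eq_or_lt with rfl | hci
    · rw [joinSep_cons, compareFrom_push]
      simp [sepThenBlocks, compareFrom, this]
    · rw [joinSep_cons, compareFrom_skip (by omega) (by omega)]
      simp [sepThenBlocks, compareFrom, this]
  | cons v l ih =>
    have hcj : c ≠ j := by omega
    rcases hci.eq_or_lt with rfl | hci
    · rw [joinSep_cons_cons, compareFrom_push, compareFrom, if_pos (by omega)]
      simp only [hcj, decide_false, Bool.false_and, Bool.false_or, List.append_nil]
      rw [compareFrom_joinSep_between hjn (by omega) (by omega),
        show j - c = j - (c + 1) + 1 by omega, List.getElem?_cons_succ, List.length_cons]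
      simp only [Nat.sub_self, List.getElem?_cons_zero, Option.map_some]
      refine and_congr_left fun _ => by omega
    · rw [joinSep_cons_cons, compareFrom_skip (by omega) (by omega), compareFrom,
        if_pos (by omega)]
      simp only [hcj, decide_false, Bool.false_and, Bool.false_or]
      rw [ih (by omega), show j - c = j - (c + 1) + 1 by omega,
        show i - c = i - (c + 1) + 1 by omega,
        List.getElem?_cons_succ, List.getElem?_cons_succ, List.length_cons]
      refine and_congr_left fun _ => by omega

variable {d : ℕ}

theorem compareFrom_hashWord (w v : Fin d → List Bool) (k : Fin d) :
    compareFrom (2 * d - 1) k (d + k) 0 false [] (hashWord w v) = true ↔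
      v k ≠ (w k).reverse := by
  have hk := k.2
  have hd : d ≠ 0 := by omega
  rw [hashWord_eq_joinSep hd]
  obtain ⟨u, l, hl⟩ := List.exists_cons_of_ne_nil
    (show List.ofFn w ++ List.ofFn v ≠ [] by simp [hd])
  have hlen := congrArg List.length hl
  simp only [List.length_append, List.length_ofFn, List.length_cons] at hlen
  rw [hl, compareFrom_joinSep (by omega) (by omega) (Nat.zero_le _), ← hl]
  have h₁ : (List.ofFn w ++ List.ofFn v)[(k : ℕ)]? = some (w k) := by
    rw [List.getElem?_append_left (by simp)]
    simp
  have h₂ : (List.ofFn w ++ List.ofFn v)[d + (k : ℕ)]? = some (v k) := by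
    rw [List.getElem?_append_right (by simp)]
    simp
  simp only [Nat.sub_zero, h₁, h₂, Option.map_some, ne_eq, Option.some.injEq]
  exact and_iff_right (by omega)

theorem exists_hashWord_of_compareFrom {k : Fin d} {x : List (Option Bool)}
    (hx : compareFrom (2 * d - 1) k (d + k) 0 false [] x = true) :
    ∃ w v : Fin d → List Bool, x = hashWord w v := by
  have hk := k.2
  obtain ⟨l, hl, rfl⟩ := exists_joinSep_eq x
  obtain ⟨u, l, rfl⟩ := List.exists_cons_of_ne_nil hl
  have hlen := ((compareFrom_joinSep (by omega) (by omega) (Nat.zero_le _) u l).1 hx).1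
  have hL : (u :: l).length = d + d := by
    rw [List.length_cons]
    omega
  refine ⟨fun i => (u :: l)[i.1], fun i => (u :: l)[d + i.1], ?_⟩
  rw [hashWord_eq_joinSep (by omega)]
  congr 1
  refine List.ext_getElem (by simp [hL]) fun m h₁ h₂ => ?_
  by_cases hm : m < d
  · rw [List.getElem_append_left (by simpa using hm)]
    simp
  · rw [List.getElem_append_right (by simpa using hm)]
    simp [Nat.add_sub_cancel' (not_lt.1 hm)]

theorem DCFLInter_NPalSharp (hd : d ≠ 0) : DCFLInter d (NPalSharp d) := by
  refine ⟨_, fun k => isDCFL_compareFrom (2 * d - 1) k (d + k), ?_⟩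
  ext x
  simp only [Set.mem_iInter, Set.mem_ofPred_eq, mem_NPalSharp_iff]
  constructor
  · rintro ⟨w, v, hwv, rfl⟩ k
    exact (compareFrom_hashWord w v k).2 (hwv k)
  · intro h
    obtain ⟨w, v, rfl⟩ := exists_hashWord_of_compareFrom (h ⟨0, by omega⟩)
    exact ⟨w, v, fun k => (compareFrom_hashWord w v k).1 (h k), rfl⟩

end UpperBound

/-- `NPal#_d` belongs to `DCFL(d)` but not to `DCFL(d−1)`. -/
theorem NPalSharp_in_DCFLInter_d_not_in_DCFLInter_pred (d : ℕ) (hd : 2 ≤ d) :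
    DCFLInter d (NPalSharp d) ∧ ¬ DCFLInter (d - 1) (NPalSharp d) := by
  exact ⟨DCFLInter_NPalSharp (by omega), not_DCFLInter_NPalSharp hd⟩

end DCFLFormal
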